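/- Strict monotonicity of the disk-exterior eigenvalue in the radius (Proposition 3.2): Let α < 0 and let 0 < R < R′. If B_R and B_{R′} are open disks in ℝ² of radii R and R′ respectively, then λ₁^α(B_{R′}^ext) < λ₁^α(B_R^ext); that is, R ↦ λ₁^α(B_R^ext) is strictly decreasing on (0, ∞). -/

import Mathlib

open MeasureTheory Metric Set Bornology Real Filter

noncomputable section

/-- The Euclidean plane. -/
abbrev E2 := EuclideanSpace ℝ (Fin 2)

/-- The exterior of a set: complement of its closure. -/
def extDom (Ω : Set E2) : Set E2 := (closure Ω)ᶜ

/-- The lowest Robin eigenvalue of the exterior of `Ω`, defined variationally as the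
infimum of Rayleigh quotients over smooth compactly supported test functions that are
not identically zero on the exterior. -/
def robinEig (α : ℝ) (Ω : Set E2) : ℝ :=
  sInf { q : ℝ | ∃ u : E2 → ℝ, ContDiff ℝ (⊤ : ℕ∞) u ∧ HasCompactSupport u ∧
    (∃ x ∈ extDom Ω, u x ≠ 0) ∧
    q = ((∫ x in extDom Ω, ‖fderiv ℝ u x‖ ^ 2) +
          α * ∫ x in frontier Ω, (u x) ^ 2 ∂(μH[1])) /
        (∫ x in extDom Ω, (u x) ^ 2) }

/-- A planar set has smooth boundary if its topological boundary is the image of a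
smooth, periodic, regular, injective (on one period) closed curve. -/
def HasSmoothBoundary (Ω : Set E2) : Prop :=
  ∃ γ : ℝ → E2, ContDiff ℝ (⊤ : ℕ∞) γ ∧ (∀ t, γ (t + 1) = γ t) ∧
    (∀ t, deriv γ t ≠ 0) ∧ InjOn γ (Ico 0 1) ∧ range γ = frontier Ω


open scoped Topology ContDiff

/-! ### The Macdonald function and its derivatives -/

/-- The moments `∫₀^∞ cosh(t)ⁿ exp (-x cosh t) dt`; for `n = 0` and `n = 1` these are the
Macdonald functions `K₀` and `K₁`. -/
def coshMoment (n : ℕ) (x : ℝ) : ℝ :=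
  ∫ t in Ioi (0 : ℝ), Real.cosh t ^ n * Real.exp (-x * Real.cosh t)

lemma self_le_cosh {t : ℝ} (ht : 0 ≤ t) : t ≤ Real.cosh t :=
  (Real.self_le_sinh_iff.2 ht).trans (Real.sinh_lt_cosh t).le

lemma cosh_pow_mul_exp_le (n : ℕ) {x t : ℝ} (hx : 0 < x) (ht : 0 ≤ t) :
    Real.cosh t ^ n * Real.exp (-x * Real.cosh t) ≤
      (n.factorial / (x / 2) ^ n) * Real.exp (-(x / 2) * t) := by
  have hc := Real.cosh_pos t
  have h1 := Real.pow_div_factorial_le_exp (x / 2 * Real.cosh t) (by positivity) n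
  rw [mul_pow, div_le_iff₀ (by positivity)] at h1
  have h2 : Real.exp (-x * Real.cosh t) =
      Real.exp (-(x / 2) * Real.cosh t) * Real.exp (-(x / 2) * Real.cosh t) := by
    rw [← Real.exp_add]; ring_nf
  have h3 : Real.cosh t ^ n * Real.exp (-(x / 2) * Real.cosh t) ≤
      n.factorial / (x / 2) ^ n := by
    rw [le_div_iff₀ (by positivity), neg_mul, Real.exp_neg]
    have := Real.exp_pos (x / 2 * Real.cosh t)
    rw [mul_assoc, mul_comm _ ((x / 2) ^ n), ← mul_assoc, ← div_eq_mul_inv, div_le_iff₀ this]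
    linarith
  have h4 : Real.exp (-(x / 2) * Real.cosh t) ≤ Real.exp (-(x / 2) * t) := by
    apply Real.exp_le_exp.2
    have := self_le_cosh ht
    nlinarith
  rw [h2, ← mul_assoc]
  exact mul_le_mul h3 h4 (Real.exp_pos _).le (by positivity)

lemma integrableOn_cosh_pow_mul_exp (n : ℕ) {x : ℝ} (hx : 0 < x) :
    IntegrableOn (fun t ↦ Real.cosh t ^ n * Real.exp (-x * Real.cosh t)) (Ioi 0) := by
  refine Integrable.mono'
    ((exp_neg_integrableOn_Ioi (b := x / 2) 0 (by positivity)).const_mul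
      (n.factorial / (x / 2) ^ n)) (by fun_prop) ?_
  refine (ae_restrict_iff' measurableSet_Ioi).2 (.of_forall fun t (ht : 0 < t) ↦ ?_)
  have hc := Real.cosh_pos t
  rw [Real.norm_of_nonneg (by positivity)]
  exact cosh_pow_mul_exp_le n hx ht.le

lemma hasDerivAt_coshMoment (n : ℕ) {x : ℝ} (hx : 0 < x) :
    HasDerivAt (coshMoment n) (-coshMoment (n + 1) x) x := by
  have key := hasDerivAt_integral_of_dominated_loc_of_deriv_le
    (μ := volume.restrict (Ioi (0 : ℝ))) (x₀ := x) (s := Ioi (x / 2))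
    (F := fun y t ↦ Real.cosh t ^ n * Real.exp (-y * Real.cosh t))
    (F' := fun y t ↦ -(Real.cosh t ^ (n + 1) * Real.exp (-y * Real.cosh t)))
    (bound := fun t ↦ Real.cosh t ^ (n + 1) * Real.exp (-(x / 2) * Real.cosh t))
    (Ioi_mem_nhds (by linarith)) (.of_forall fun y ↦ by fun_prop)
    (integrableOn_cosh_pow_mul_exp n hx) (by fun_prop) ?_
    (integrableOn_cosh_pow_mul_exp (n + 1) (by positivity)) ?_
  · have h2 := key.2
    rwa [integral_neg] at h2
  · refine .of_forall fun t y (hy : x / 2 < y) ↦ ?_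
    have hc := Real.cosh_pos t
    rw [norm_neg, Real.norm_of_nonneg (by positivity)]
    gcongr
  · refine .of_forall fun t y _ ↦ ?_
    have h := ((((hasDerivAt_id y).neg.mul_const (Real.cosh t)).exp).const_mul (Real.cosh t ^ n))
    refine h.congr_deriv ?_
    simp only [Pi.neg_apply, id_eq]
    ring

lemma coshMoment_pos (n : ℕ) {x : ℝ} (hx : 0 < x) : 0 < coshMoment n x := by
  refine (setIntegral_pos_iff_support_of_nonneg_ae ?_ (integrableOn_cosh_pow_mul_exp n hx)).2 ?_
  · refine .of_forall fun t ↦ ?_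
    have hc := Real.cosh_pos t
    simp only [Pi.zero_apply]; positivity
  · have : (Function.support fun t ↦ Real.cosh t ^ n * Real.exp (-x * Real.cosh t)) = univ := by
      ext t
      have hc := Real.cosh_pos t
      simp [hc.ne']
    rw [this]; simp

lemma contDiffOn_coshMoment (m n : ℕ) : ContDiffOn ℝ m (coshMoment n) (Ioi 0) := by
  induction m generalizing n with
  | zero =>
    exact contDiffOn_zero.2 fun x hx ↦
      (hasDerivAt_coshMoment n hx).continuousAt.continuousWithinAt
  | succ m ih =>
    push_cast
    refine (contDiffOn_succ_iff_deriv_of_isOpen isOpen_Ioi).2 ⟨fun x hx ↦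
      (hasDerivAt_coshMoment n hx).differentiableAt.differentiableWithinAt, by simp, ?_⟩
    exact (ih (n + 1)).neg.congr fun x hx ↦ (hasDerivAt_coshMoment n hx).deriv

lemma tendsto_cosh_mul_exp {x : ℝ} (hx : 0 < x) :
    Tendsto (fun t ↦ Real.cosh t * Real.exp (-x * Real.cosh t)) atTop (𝓝 0) := by
  have h : Tendsto (fun t ↦ (Nat.factorial 1 / (x / 2) ^ 1) * Real.exp (-(x / 2) * t)) atTop
      (𝓝 ((Nat.factorial 1 / (x / 2) ^ 1) * 0)) := by
    refine Tendsto.const_mul _ (Real.tendsto_exp_atBot.comp ?_)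
    exact tendsto_id.const_mul_atTop_of_neg (by linarith)
  rw [mul_zero] at h
  refine tendsto_of_tendsto_of_tendsto_of_le_of_le' tendsto_const_nhds h ?_ ?_
  · exact .of_forall fun t ↦ mul_nonneg (Real.cosh_pos t).le (Real.exp_pos _).le
  · filter_upwards [eventually_ge_atTop 0] with t ht
    simpa using cosh_pow_mul_exp_le 1 hx ht

lemma coshMoment_zero_le_one {x : ℝ} (hx : 0 < x) : coshMoment 0 x ≤ coshMoment 1 x := by
  refine setIntegral_mono (integrableOn_cosh_pow_mul_exp 0 hx)
    (integrableOn_cosh_pow_mul_exp 1 hx) fun t ↦ ?_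
  simp only [pow_zero, pow_one]
  gcongr
  exact Real.one_le_cosh t

lemma tendsto_sinh_mul_exp {x : ℝ} (hx : 0 < x) :
    Tendsto (fun t ↦ Real.sinh t * Real.exp (-x * Real.cosh t)) atTop (𝓝 0) := by
  refine tendsto_of_tendsto_of_tendsto_of_le_of_le' tendsto_const_nhds
    (tendsto_cosh_mul_exp hx) ?_ ?_
  · filter_upwards [eventually_ge_atTop 0] with t ht
    exact mul_nonneg (Real.sinh_nonneg_iff.2 ht) (Real.exp_pos _).le
  · filter_upwards with t
    gcongr
    exact (Real.sinh_lt_cosh t).le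

/-- The modified Bessel equation `K₀'' + K₀' / x = K₀`. -/
lemma coshMoment_two {x : ℝ} (hx : 0 < x) :
    coshMoment 2 x = coshMoment 0 x + coshMoment 1 x / x := by
  have i0 := integrableOn_cosh_pow_mul_exp 0 hx
  have i1 := integrableOn_cosh_pow_mul_exp 1 hx
  have i2 := integrableOn_cosh_pow_mul_exp 2 hx
  have key := integral_Ioi_of_hasDerivAt_of_tendsto'
    (f := fun t ↦ Real.sinh t * Real.exp (-x * Real.cosh t)) (a := 0) (m := 0)
    (f' := fun t ↦ Real.cosh t ^ 1 * Real.exp (-x * Real.cosh t) -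
      x * (Real.cosh t ^ 2 * Real.exp (-x * Real.cosh t) -
        Real.cosh t ^ 0 * Real.exp (-x * Real.cosh t))) ?_
    (i1.sub ((i2.sub i0).const_mul x)) (tendsto_sinh_mul_exp hx)
  · have i20 : IntegrableOn (fun t ↦ x * (Real.cosh t ^ 2 * Real.exp (-x * Real.cosh t) -
        Real.cosh t ^ 0 * Real.exp (-x * Real.cosh t))) (Ioi 0) := (i2.sub i0).const_mul x
    rw [integral_sub i1 i20, integral_const_mul, integral_sub i2 i0] at key
    simp only [Real.sinh_zero, zero_mul, sub_zero] at key
    change coshMoment 1 x - x * (coshMoment 2 x - coshMoment 0 x) = 0 at key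
    field_simp
    linarith
  · intro t _
    have h := (Real.hasDerivAt_sinh t).mul (((Real.hasDerivAt_cosh t).const_mul (-x)).exp)
    refine h.congr_deriv ?_
    have := Real.cosh_sq t
    linear_combination (x * Real.exp (-x * Real.cosh t)) * this

lemma mul_coshMoment_one_le {x : ℝ} (hx : 0 < x) : x * coshMoment 1 x ≤ 1 + x := by
  have i1 := integrableOn_cosh_pow_mul_exp 1 hx
  have ie : IntegrableOn (fun t ↦ Real.exp (-1 * t)) (Ioi (0 : ℝ)) :=
    exp_neg_integrableOn_Ioi 0 one_pos
  have hsinh : ∀ t ∈ Ici (0 : ℝ), HasDerivAt (fun t ↦ -Real.exp (-x * Real.cosh t))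
      (x * (Real.sinh t * Real.exp (-x * Real.cosh t))) t := fun t _ ↦ by
    have h := (((Real.hasDerivAt_cosh t).const_mul (-x)).exp).neg
    refine h.congr_deriv ?_
    ring
  have hlim : Tendsto (fun t ↦ -Real.exp (-x * Real.cosh t)) atTop (𝓝 0) := by
    rw [← neg_zero]
    refine (tendsto_of_tendsto_of_tendsto_of_le_of_le tendsto_const_nhds
      (tendsto_cosh_mul_exp hx) (fun t ↦ (Real.exp_pos _).le) fun t ↦ ?_).neg
    exact le_mul_of_one_le_left (Real.exp_pos _).le (Real.one_le_cosh t)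
  have is : IntegrableOn (fun t ↦ x * (Real.sinh t * Real.exp (-x * Real.cosh t))) (Ioi 0) :=
    integrableOn_Ioi_deriv_of_nonneg' hsinh (fun t (ht : 0 < t) ↦ by
      have := (Real.sinh_pos_iff.2 ht).le; positivity) hlim
  have hs := integral_Ioi_of_hasDerivAt_of_tendsto' hsinh is hlim
  have hle : ∫ t in Ioi (0 : ℝ), x * (Real.cosh t ^ 1 * Real.exp (-x * Real.cosh t)) ≤
      ∫ t in Ioi (0 : ℝ), (x * (Real.sinh t * Real.exp (-x * Real.cosh t)) +
        x * Real.exp (-1 * t)) := by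
    refine setIntegral_mono (i1.const_mul x) (is.add (ie.const_mul x)) fun t ↦ ?_
    have h1 : Real.cosh t = Real.sinh t + Real.exp (-t) := by
      rw [Real.cosh_eq, Real.sinh_eq]; ring
    have h2 : Real.exp (-x * Real.cosh t) ≤ 1 := by
      apply Real.exp_le_one_iff.2
      have := Real.cosh_pos t
      nlinarith
    have h3 := Real.exp_pos (-t)
    simp only [pow_one, neg_mul, one_mul] at h2 ⊢
    nth_rewrite 1 [h1]
    have := mul_le_mul_of_nonneg_left h2 (mul_pos hx h3).le
    linarith
  rw [integral_const_mul, integral_add is (ie.const_mul x), hs, integral_const_mul,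
    integral_exp_mul_Ioi (by norm_num)] at hle
  change x * coshMoment 1 x ≤ _ at hle
  have h1 : Real.exp (-x * Real.cosh 0) ≤ 1 := by
    rw [Real.cosh_zero, mul_one]
    exact Real.exp_le_one_iff.2 (by linarith)
  norm_num at hle
  rw [Real.cosh_zero, mul_one] at h1
  linarith

lemma exists_lt_coshMoment_zero (A : ℝ) {δ : ℝ} (hδ : 0 < δ) :
    ∃ x, 0 < x ∧ x < δ ∧ A < coshMoment 0 x := by
  set T : ℝ := (|A| + 1) * Real.exp 1 with hT
  have hT0 : 0 < T := by positivity
  have hc := Real.cosh_pos T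
  set x : ℝ := min (δ / 2) (1 / Real.cosh T) with hx
  have hx0 : 0 < x := lt_min (by positivity) (by positivity)
  have hxT : x * Real.cosh T ≤ 1 := (le_div_iff₀ hc).1 (min_le_right _ _)
  refine ⟨x, hx0, (min_le_left _ _).trans_lt (by linarith), ?_⟩
  have hi := integrableOn_cosh_pow_mul_exp 0 hx0
  have h1 : ∫ t in Ioc 0 T, Real.cosh t ^ 0 * Real.exp (-x * Real.cosh t) ≤ coshMoment 0 x :=
    setIntegral_mono_set hi (.of_forall fun t ↦ by
      have := Real.exp_pos (-x * Real.cosh t)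
      simp only [pow_zero, one_mul, Pi.zero_apply]; positivity) (.of_forall fun t ht ↦ ht.1)
  have h2 : ∫ _t in Ioc 0 T, Real.exp (-1) ≤
      ∫ t in Ioc 0 T, Real.cosh t ^ 0 * Real.exp (-x * Real.cosh t) := by
    refine setIntegral_mono_on (by simp) (hi.mono_set fun t ht ↦ ht.1) measurableSet_Ioc
      fun t ht ↦ ?_
    rw [pow_zero, one_mul]
    apply Real.exp_le_exp.2
    have : Real.cosh t ≤ Real.cosh T :=
      Real.cosh_le_cosh.2 (by rw [abs_of_pos ht.1, abs_of_pos hT0]; exact ht.2)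
    nlinarith
  have h3 : ∫ _t in Ioc 0 T, Real.exp (-1) = |A| + 1 := by
    rw [setIntegral_const, smul_eq_mul, Real.volume_real_Ioc_of_le hT0.le, hT, sub_zero, mul_assoc,
      ← Real.exp_add]
    norm_num
  linarith [le_abs_self A]

lemma coshMoment_zero_le_exp {x : ℝ} (hx : 1 ≤ x) :
    coshMoment 0 x ≤ Real.exp (1 - x) * coshMoment 0 1 := by
  unfold coshMoment
  rw [← integral_const_mul]
  refine setIntegral_mono (integrableOn_cosh_pow_mul_exp 0 (by linarith))
    ((integrableOn_cosh_pow_mul_exp 0 one_pos).const_mul _) fun t ↦ ?_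
  simp only [pow_zero, one_mul]
  rw [← Real.exp_add]
  apply Real.exp_le_exp.2
  nlinarith [Real.one_le_cosh t]

/-- A radial profile `f` which is a positive decreasing solution of `f'' + f' / r = k² f` decaying
at infinity and satisfying the Robin condition `f' = -β f` at `R`. -/
structure IsRobinProfile (β R k : ℝ) (f f' : ℝ → ℝ) : Prop where
  contDiffOn : ContDiffOn ℝ ∞ f (Ioi 0)
  pos : ∀ r, 0 < r → 0 < f r
  hasDerivAt : ∀ r, 0 < r → HasDerivAt f (f' r) r
  deriv_neg : ∀ r, 0 < r → f' r < 0
  hasDerivAt_deriv : ∀ r, 0 < r → HasDerivAt f' (k ^ 2 * f r - f' r / r) r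
  robin : f' R = -β * f R
  tendsto : ∀ d, Tendsto (fun r ↦ (r + d) * f r ^ 2) atTop (𝓝 0)

lemma exists_robin_parameter {β R : ℝ} (hβ : 0 < β) (hR : 0 < R) :
    ∃ k, 0 < k ∧ k * coshMoment 1 (k * R) = β * coshMoment 0 (k * R) := by
  obtain ⟨x, hx0, hxδ, hx⟩ := exists_lt_coshMoment_zero (2 / (β * R))
    (δ := min 1 (β * R)) (by positivity)
  have hx1 : x < 1 := hxδ.trans_le (min_le_left _ _)
  have hxβ : x < β * R := hxδ.trans_le (min_le_right _ _)
  have hcont : ContinuousOn (fun k ↦ k * coshMoment 1 (k * R) - β * coshMoment 0 (k * R))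
      (Icc (x / R) β) := by
    intro k hk
    have hk0 : 0 < k * R := mul_pos ((div_pos hx0 hR).trans_le hk.1) hR
    have hd : ∀ n, ContinuousAt (fun k ↦ coshMoment n (k * R)) k := fun n ↦
      ContinuousAt.comp (f := fun k ↦ k * R) (hasDerivAt_coshMoment n hk0).continuousAt
        (by fun_prop)
    exact ((continuousAt_id.mul (hd 1)).sub (continuousAt_const.mul (hd 0))).continuousWithinAt
  have hle : x / R ≤ β := (div_le_iff₀ hR).2 hxβ.le
  have h0 : x / R * coshMoment 1 (x / R * R) - β * coshMoment 0 (x / R * R) ≤ 0 := by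
    rw [div_mul_cancel₀ _ hR.ne']
    rw [div_lt_iff₀ (by positivity)] at hx
    have h1 := mul_coshMoment_one_le hx0
    rw [div_mul_eq_mul_div, sub_nonpos, div_le_iff₀ hR]
    linarith
  have h1 : 0 ≤ β * coshMoment 1 (β * R) - β * coshMoment 0 (β * R) := by
    have := coshMoment_zero_le_one (mul_pos hβ hR)
    nlinarith
  obtain ⟨k, hk, hk0⟩ := intermediate_value_Icc hle hcont ⟨h0, h1⟩
  exact ⟨k, (div_pos hx0 hR).trans_le hk.1, sub_eq_zero.1 hk0⟩

lemma exists_isRobinProfile {β R : ℝ} (hβ : 0 < β) (hR : 0 < R) :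
    ∃ k f f', 0 < k ∧ IsRobinProfile β R k f f' := by
  obtain ⟨k, hk, hkβ⟩ := exists_robin_parameter hβ hR
  have hd : ∀ n r, 0 < r → HasDerivAt (fun r ↦ coshMoment n (k * r))
      (-k * coshMoment (n + 1) (k * r)) r := fun n r hr ↦ by
    have h := (hasDerivAt_coshMoment n (mul_pos hk hr)).comp r ((hasDerivAt_id r).const_mul k)
    exact h.congr_deriv (by ring)
  refine ⟨k, fun r ↦ coshMoment 0 (k * r), fun r ↦ -k * coshMoment 1 (k * r), hk, ?_, ?_, ?_, ?_,
    ?_, ?_, ?_⟩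
  · have hK : ContDiffOn ℝ ∞ (coshMoment 0) (Ioi 0) :=
      contDiffOn_infty.2 fun m ↦ contDiffOn_coshMoment m 0
    exact hK.comp (f := fun r ↦ k * r) (s := Ioi 0) (by fun_prop)
      fun r (hr : 0 < r) ↦ mul_pos hk hr
  · exact fun r hr ↦ coshMoment_pos 0 (mul_pos hk hr)
  · exact fun r hr ↦ hd 0 r hr
  · intro r hr
    have := mul_pos hk (coshMoment_pos 1 (mul_pos hk hr))
    linarith
  · intro r hr
    refine ((hd 1 r hr).const_mul (-k)).congr_deriv ?_
    rw [coshMoment_two (mul_pos hk hr)]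
    field_simp
    ring
  · linarith
  · intro d
    have h1 : Tendsto (fun r : ℝ ↦ (r + d) * Real.exp (-(2 * k) * r)) atTop (𝓝 0) := by
      have ha : Tendsto (fun r : ℝ ↦ r ^ 1 * Real.exp (-(2 * k) * r)) atTop (𝓝 0) := by
        simpa using tendsto_rpow_mul_exp_neg_mul_atTop_nhds_zero 1 (2 * k) (by positivity)
      have hb : Tendsto (fun r : ℝ ↦ r ^ 0 * Real.exp (-(2 * k) * r)) atTop (𝓝 0) := by
        simpa using tendsto_rpow_mul_exp_neg_mul_atTop_nhds_zero 0 (2 * k) (by positivity)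
      simpa [add_mul] using ha.add (hb.const_mul d)
    have h2 := h1.const_mul ((Real.exp 1 * coshMoment 0 1) ^ 2)
    rw [mul_zero] at h2
    refine tendsto_of_tendsto_of_tendsto_of_le_of_le' tendsto_const_nhds h2 ?_ ?_
    · filter_upwards [eventually_ge_atTop (-d)] with r hr
      have : 0 ≤ r + d := by linarith
      positivity
    · filter_upwards [eventually_ge_atTop (-d), eventually_ge_atTop (1 / k)] with r hr hr1
      have hrd : 0 ≤ r + d := by linarith
      have hkr : 1 ≤ k * r := by rwa [div_le_iff₀' hk] at hr1
      have h3 := pow_le_pow_left₀ (coshMoment_pos 0 (by linarith)).le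
        (coshMoment_zero_le_exp hkr) 2
      calc (r + d) * coshMoment 0 (k * r) ^ 2
          ≤ (r + d) * (Real.exp (1 - k * r) * coshMoment 0 1) ^ 2 := by gcongr
        _ = _ := by
          have h4 : Real.exp (1 - k * r) ^ 2 = Real.exp 1 ^ 2 * Real.exp (-(2 * k) * r) := by
            rw [← Real.exp_nat_mul, ← Real.exp_nat_mul, ← Real.exp_add]
            congr 1; push_cast; ring
          rw [mul_pow, h4]; ring

/-! ### One-dimensional identities -/

lemma integrableOn_Ioi_of_eq_zero {F : ℝ → ℝ} {a L : ℝ} (hF : ContinuousOn F (Ici a))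
    (hL : ∀ r, L ≤ r → F r = 0) : IntegrableOn F (Ioi a) := by
  refine IntegrableOn.of_forall_sdiff_eq_zero
    ((hF.mono Icc_subset_Ici_self).integrableOn_Icc (b := L)) measurableSet_Ioi ?_
  intro r hr
  refine hL r ?_
  by_contra hlt
  exact hr.2 ⟨(mem_Ioi.1 hr.1).le, (not_le.1 hlt).le⟩

/-- Ground state representation of the radial energy, with respect to a shifted profile. -/
lemma IsRobinProfile.integral_eq {β R k : ℝ} {f f' : ℝ → ℝ} (h : IsRobinProfile β R k f f')
    (hR : 0 < R) {d : ℝ} {U U' : ℝ → ℝ} {L : ℝ}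
    (hU : ∀ r, HasDerivAt U (U' r) r) (hU' : Continuous U') (hUL : ∀ r, L ≤ r → U r = 0)
    (hUL' : ∀ r, L ≤ r → U' r = 0) :
    IntegrableOn (fun r ↦ r * (U' r - f' (r - d) / f (r - d) * U r) ^ 2 +
      d / (r - d) * (f' (r - d) / f (r - d)) * U r ^ 2) (Ioi (R + d)) ∧
    ∫ r in Ioi (R + d), r * (U' r ^ 2 + k ^ 2 * U r ^ 2) =
      β * ((R + d) * U (R + d) ^ 2) +
        ∫ r in Ioi (R + d), (r * (U' r - f' (r - d) / f (r - d) * U r) ^ 2 +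
          d / (r - d) * (f' (r - d) / f (r - d)) * U r ^ 2) := by
  have hUc : Continuous U := continuous_iff_continuousAt.2 fun r ↦ (hU r).continuousAt
  have hpos : ∀ r ∈ Ici (R + d), 0 < r - d := fun r hr ↦ by
    have := mem_Ici.1 hr; linarith
  have hfc : ContinuousOn (fun r ↦ f (r - d)) (Ici (R + d)) := fun r hr ↦
    (ContinuousAt.comp (f := fun r ↦ r - d) (h.hasDerivAt _ (hpos r hr)).continuousAt
      (by fun_prop)).continuousWithinAt
  have hfc' : ContinuousOn (fun r ↦ f' (r - d)) (Ici (R + d)) := fun r hr ↦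
    (ContinuousAt.comp (f := fun r ↦ r - d) (h.hasDerivAt_deriv _ (hpos r hr)).continuousAt
      (by fun_prop)).continuousWithinAt
  have hgc : ContinuousOn (fun r ↦ f' (r - d) / f (r - d)) (Ici (R + d)) :=
    hfc'.div hfc fun r hr ↦ (h.pos _ (hpos r hr)).ne'
  have hQ : IntegrableOn (fun r ↦ r * (U' r ^ 2 + k ^ 2 * U r ^ 2)) (Ioi (R + d)) :=
    integrableOn_Ioi_of_eq_zero (L := L) (by fun_prop) fun r hr ↦ by simp [hUL r hr, hUL' r hr]
  have hE : IntegrableOn (fun r ↦ r * (U' r - f' (r - d) / f (r - d) * U r) ^ 2 +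
      d / (r - d) * (f' (r - d) / f (r - d)) * U r ^ 2) (Ioi (R + d)) := by
    refine integrableOn_Ioi_of_eq_zero (L := L) ?_ fun r hr ↦ by simp [hUL r hr, hUL' r hr]
    have hdc : ContinuousOn (fun r ↦ d / (r - d)) (Ici (R + d)) :=
      continuousOn_const.div (by fun_prop) fun r hr ↦ (hpos r hr).ne'
    fun_prop
  refine ⟨hE, ?_⟩
  have key := integral_Ioi_of_hasDerivAt_of_tendsto' (a := R + d) (m := 0)
    (f := fun r ↦ r * U r ^ 2 * (f' (r - d) / f (r - d)))
    (f' := fun r ↦ r * (U' r ^ 2 + k ^ 2 * U r ^ 2) -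
      (r * (U' r - f' (r - d) / f (r - d) * U r) ^ 2 +
      d / (r - d) * (f' (r - d) / f (r - d)) * U r ^ 2)) ?_ (hQ.sub hE) ?_
  · rw [integral_sub hQ hE, add_sub_cancel_right, h.robin,
      mul_div_cancel_right₀ _ (h.pos R hR).ne'] at key
    linarith
  · intro r hr
    have hr0 := hpos r hr
    have hf0 := (h.pos _ hr0).ne'
    have hs : HasDerivAt (fun r ↦ r - d) 1 r := (hasDerivAt_id r).sub_const d
    have h1 := (HasDerivAt.comp r (h.hasDerivAt_deriv _ hr0) hs).fun_div
      (HasDerivAt.comp r (h.hasDerivAt _ hr0) hs) hf0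
    have h2 := ((hasDerivAt_id r).fun_mul ((hU r).fun_pow 2)).fun_mul h1
    refine h2.congr_deriv ?_
    simp only [Function.comp_apply, id_eq]
    field_simp
    ring
  · refine tendsto_const_nhds.congr' ?_
    filter_upwards [eventually_ge_atTop L] with r hr
    simp [hUL r hr]

lemma IsRobinProfile.le_integral {β R k : ℝ} {f f' : ℝ → ℝ} (h : IsRobinProfile β R k f f')
    (hR : 0 < R) {U U' : ℝ → ℝ} {L : ℝ}
    (hU : ∀ r, HasDerivAt U (U' r) r) (hU' : Continuous U') (hUL : ∀ r, L ≤ r → U r = 0)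
    (hUL' : ∀ r, L ≤ r → U' r = 0) :
    β * (R * U R ^ 2) ≤ ∫ r in Ioi R, r * (U' r ^ 2 + k ^ 2 * U r ^ 2) := by
  have key := (h.integral_eq hR (d := 0) hU hU' hUL hUL').2
  rw [add_zero] at key
  rw [key, le_add_iff_nonneg_right]
  refine setIntegral_nonneg measurableSet_Ioi fun r hr ↦ ?_
  have : 0 < r := hR.trans hr
  rw [zero_div, zero_mul, zero_mul, add_zero]
  positivity

lemma deriv_smoothTransition_eq_zero {x : ℝ} (hx : x ∉ Icc (0 : ℝ) 1) :
    deriv Real.smoothTransition x = 0 := by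
  rcases not_and_or.1 hx with h | h
  · have : Real.smoothTransition =ᶠ[𝓝 x] fun _ ↦ 0 := by
      filter_upwards [Iio_mem_nhds (not_le.1 h)] with y hy
      exact Real.smoothTransition.zero_of_nonpos (mem_Iio.1 hy).le
    rw [this.deriv_eq, deriv_const]
  · have : Real.smoothTransition =ᶠ[𝓝 x] fun _ ↦ 1 := by
      filter_upwards [Ioi_mem_nhds (not_le.1 h)] with y hy
      exact Real.smoothTransition.one_of_one_le (mem_Ioi.1 hy).le
    rw [this.deriv_eq, deriv_const]

lemma exists_abs_deriv_smoothTransition_le :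
    ∃ C, 0 < C ∧ ∀ x, |deriv Real.smoothTransition x| ≤ C := by
  have hc : Continuous (deriv Real.smoothTransition) :=
    (Real.smoothTransition.contDiff (n := 1)).continuous_deriv le_rfl
  obtain ⟨C, hC⟩ := isCompact_Icc.exists_bound_of_continuousOn (s := Icc (0 : ℝ) 1) hc.continuousOn
  refine ⟨max C 1, by positivity, fun x ↦ ?_⟩
  by_cases hx : x ∈ Icc (0 : ℝ) 1
  · exact (hC x hx).trans (le_max_left _ _)
  · rw [deriv_smoothTransition_eq_zero hx, abs_zero]; positivity

lemma IsRobinProfile.contDiff_shift_cutoff {β R k : ℝ} {f f' : ℝ → ℝ}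
    (h : IsRobinProfile β R k f f') (hR : 0 < R) (d : ℝ) :
    ContDiff ℝ ∞ fun r ↦ f (r - d) * Real.smoothTransition (3 * (r - d) / R - 1) := by
  refine contDiff_iff_contDiffAt.2 fun r ↦ ?_
  rcases lt_or_ge d r with hr | hr
  · have h1 : ContDiffAt ℝ ∞ f (r - d) :=
      h.contDiffOn.contDiffAt (Ioi_mem_nhds (by linarith))
    have h2 : ContDiffAt ℝ ∞ (fun r ↦ f (r - d)) r :=
      ContDiffAt.comp (f := fun r ↦ r - d) r h1 (by fun_prop)
    exact h2.mul (Real.smoothTransition.contDiff.comp (by fun_prop)).contDiffAt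
  · have : (fun r ↦ f (r - d) * Real.smoothTransition (3 * (r - d) / R - 1)) =ᶠ[𝓝 r]
        fun _ ↦ 0 := by
      filter_upwards [Iio_mem_nhds (show r < d + R / 3 by linarith)] with y hy
      rw [Real.smoothTransition.zero_of_nonpos, mul_zero]
      have := mem_Iio.1 hy
      rw [sub_nonpos, div_le_one hR]
      linarith
    exact contDiffAt_const.congr_of_eventuallyEq this

/-- Shifting the profile outwards and cutting off far away produces negative energy. -/
lemma IsRobinProfile.exists_test {β R k : ℝ} {f f' : ℝ → ℝ} (h : IsRobinProfile β R k f f')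
    (hR : 0 < R) {d : ℝ} (hd : 0 < d) :
    ∃ φ : ℝ → ℝ, ContDiff ℝ ∞ φ ∧ (∃ ε, 0 < ε ∧ ∀ r, r ≤ ε → φ r = 0) ∧
      (∃ L, ∀ r, L ≤ r → φ r = 0) ∧
      ∫ r in Ioi (R + d), r * (deriv φ r ^ 2 + k ^ 2 * φ r ^ 2) <
        β * ((R + d) * φ (R + d) ^ 2) := by
  obtain ⟨C, hC0, hC⟩ := exists_abs_deriv_smoothTransition_le
  have hpos : ∀ r ∈ Ici (R + d), 0 < r - d := fun r hr ↦ by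
    have := mem_Ici.1 hr; linarith
  set p : ℝ → ℝ := fun r ↦ d / (r - d) * (f' (r - d) / f (r - d)) * f (r - d) ^ 2 with hp
  have hp_neg : ∀ r ∈ Ici (R + d), p r < 0 := fun r hr ↦ by
    have h0 := hpos r hr
    have h1 := h.pos _ h0
    have h2 := div_neg_of_neg_of_pos (h.deriv_neg _ h0) h1
    exact mul_neg_of_neg_of_pos (mul_neg_of_pos_of_neg (by positivity) h2) (by positivity)
  have hp_cont : ContinuousOn p (Ici (R + d)) := by
    intro r hr
    have h0 := hpos r hr
    have h1 : ContinuousAt (fun r ↦ f (r - d)) r :=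
      ContinuousAt.comp (f := fun r ↦ r - d) (h.hasDerivAt _ h0).continuousAt (by fun_prop)
    have h2 : ContinuousAt (fun r ↦ f' (r - d)) r :=
      ContinuousAt.comp (f := fun r ↦ r - d) (h.hasDerivAt_deriv _ h0).continuousAt (by fun_prop)
    have h3 : ContinuousAt (fun r ↦ d / (r - d)) r :=
      continuousAt_const.div (by fun_prop) h0.ne'
    exact ((h3.mul (h2.div h1 (h.pos _ h0).ne')).mul (h1.pow 2)).continuousWithinAt
  have hp_int : IntegrableOn p (Icc (R + d) (R + d + 1)) :=
    (hp_cont.mono Icc_subset_Ici_self).integrableOn_Icc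
  set m : ℝ := -∫ r in Icc (R + d) (R + d + 1), p r with hm
  have hm0 : 0 < m := by
    rw [hm, ← integral_neg]
    refine (setIntegral_pos_iff_support_of_nonneg_ae ?_ hp_int.neg).2 ?_
    · refine (ae_restrict_iff' measurableSet_Icc).2 (.of_forall fun r hr ↦ ?_)
      have := hp_neg r (Icc_subset_Ici_self hr)
      simp only [Pi.zero_apply, Pi.neg_apply]; linarith
    · have : (Function.support (fun r ↦ -p r)) ∩ Icc (R + d) (R + d + 1) =
          Icc (R + d) (R + d + 1) :=
        inter_eq_right.2 fun r hr ↦ by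
          have := hp_neg r (Icc_subset_Ici_self hr)
          simp [this.ne]
      change 0 < volume ((Function.support fun r ↦ -p r) ∩ Icc (R + d) (R + d + 1))
      rw [this]; simp
  have htend : Tendsto (fun r ↦ C ^ 2 * (r * f (r - d) ^ 2)) atTop (𝓝 0) := by
    have h1 := ((h.tendsto d).comp (tendsto_atTop_add_const_right atTop (-d) tendsto_id)).const_mul
      (C ^ 2)
    rw [mul_zero] at h1
    refine h1.congr fun r ↦ ?_
    simp [sub_eq_add_neg]
  obtain ⟨n, hn⟩ := ((htend.eventually_lt_const (half_pos hm0)).and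
    (eventually_ge_atTop (R + d + 1))).exists_forall_of_atTop
  have hnR : R + d + 1 ≤ n := (hn n le_rfl).2
  set ψ : ℝ → ℝ := fun r ↦ f (r - d) * Real.smoothTransition (3 * (r - d) / R - 1) with hψ
  set η : ℝ → ℝ := fun r ↦ Real.smoothTransition (n + 1 - r) with hη
  have hηs : ContDiff ℝ ∞ η := Real.smoothTransition.contDiff.comp (by fun_prop)
  have hφs : ContDiff ℝ ∞ fun r ↦ ψ r * η r := (h.contDiff_shift_cutoff hR d).mul hηs
  have hψf : ∀ r, R + d - R / 3 ≤ r → ψ r = f (r - d) := fun r hr ↦ by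
    rw [hψ]; simp only
    rw [Real.smoothTransition.one_of_one_le, mul_one]
    rw [le_sub_iff_add_le, le_div_iff₀ hR]; linarith
  have hηd : ∀ r, HasDerivAt η (-deriv Real.smoothTransition (n + 1 - r)) r := fun r ↦ by
    have h1 : HasDerivAt Real.smoothTransition (deriv Real.smoothTransition (n + 1 - r))
        (n + 1 - r) :=
      ((Real.smoothTransition.contDiff (n := 1)).differentiable one_ne_zero _).hasDerivAt
    have h2 := HasDerivAt.comp r h1 ((hasDerivAt_id r).const_sub (n + 1))
    exact h2.congr_deriv (by simp)
  have hη0 : ∀ r, n + 1 ≤ r → η r = 0 := fun r hr ↦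
    Real.smoothTransition.zero_of_nonpos (by linarith)
  have hφd : ∀ r, HasDerivAt (fun r ↦ ψ r * η r) (deriv (fun r ↦ ψ r * η r) r) r := fun r ↦
    (hφs.differentiable (by simp) r).hasDerivAt
  have hderiv : ∀ r ∈ Ioi (R + d), deriv (fun r ↦ ψ r * η r) r = f' (r - d) * η r +
      f (r - d) * -deriv Real.smoothTransition (n + 1 - r) := fun r hr ↦ by
    have hr := mem_Ioi.1 hr
    have he : (fun r ↦ ψ r * η r) =ᶠ[𝓝 r] fun r ↦ f (r - d) * η r := by
      filter_upwards [Ioi_mem_nhds (show R + d - R / 3 < r by linarith)] with y hy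
      rw [hψf y (mem_Ioi.1 hy).le]
    rw [he.deriv_eq]
    have h1 := HasDerivAt.comp r (h.hasDerivAt (r - d) (by linarith))
      ((hasDerivAt_id r).sub_const d)
    exact ((h1.fun_mul (hηd r)).congr_deriv (by simp)).deriv
  refine ⟨fun r ↦ ψ r * η r, hφs, ⟨d + R / 3, by positivity, fun r hr ↦ ?_⟩,
    ⟨n + 1, fun r hr ↦ by simp [hη0 r hr]⟩, ?_⟩
  · simp only [hψ]
    rw [Real.smoothTransition.zero_of_nonpos, mul_zero, zero_mul]
    rw [sub_nonpos, div_le_one hR]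
    linarith
  have hL' : ∀ r, n + 2 ≤ r → deriv (fun r ↦ ψ r * η r) r = 0 := fun r hr ↦ by
    have he : (fun r ↦ ψ r * η r) =ᶠ[𝓝 r] fun _ ↦ 0 := by
      filter_upwards [Ioi_mem_nhds (show n + 1 < r by linarith)] with y hy
      rw [hη0 y (mem_Ioi.1 hy).le, mul_zero]
    rw [he.deriv_eq, deriv_const]
  obtain ⟨hE, key⟩ := h.integral_eq hR (d := d) (L := n + 2) hφd (hφs.continuous_deriv (by simp))
    (fun r hr ↦ by rw [hη0 r (by linarith), mul_zero]) hL'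
  rw [key, add_lt_iff_neg_left]
  have hb1 : IntegrableOn ((Icc (R + d) (R + d + 1)).indicator p) (Ioi (R + d)) :=
    (hp_int.integrable_indicator measurableSet_Icc).integrableOn
  have hb2 : IntegrableOn ((Icc n (n + 1)).indicator fun _ ↦ m / 2) (Ioi (R + d)) :=
    ((integrableOn_const (by simp)).integrable_indicator measurableSet_Icc).integrableOn
  have hb2_le : ∫ r in Ioi (R + d), (Icc n (n + 1)).indicator (fun _ ↦ m / 2) r ≤ m / 2 := by
    refine (setIntegral_le_integral ((integrableOn_const (by simp)).integrable_indicator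
      measurableSet_Icc) (.of_forall fun r ↦ indicator_nonneg (fun _ _ ↦ (half_pos hm0).le) r)).trans
      ?_
    rw [integral_indicator measurableSet_Icc]
    simp
  have hb1_eq : ∫ r in Ioi (R + d), (Icc (R + d) (R + d + 1)).indicator p r = -m := by
    rw [setIntegral_indicator measurableSet_Icc, hm, neg_neg, integral_Icc_eq_integral_Ioc]
    congr 2
    ext r
    simp only [mem_inter_iff, mem_Ioi, mem_Icc, mem_Ioc]
    constructor
    · rintro ⟨h1, h2, h3⟩; exact ⟨h1, h3⟩
    · rintro ⟨h1, h3⟩; exact ⟨h1, h1.le, h3⟩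
  refine lt_of_le_of_lt (b := ∫ r in Ioi (R + d), ((Icc (R + d) (R + d + 1)).indicator p r +
    (Icc n (n + 1)).indicator (fun _ ↦ m / 2) r)) ?_ ?_
  swap
  · rw [integral_add hb1 hb2, hb1_eq]; linarith
  refine setIntegral_mono_on hE (hb1.add hb2) measurableSet_Ioi fun r hr ↦ ?_
  have hr' := mem_Ioi.1 hr
  have hf0 := h.pos (r - d) (by linarith)
  have hr0 : 0 < r := by linarith
  rw [hderiv r hr, hψf r (by linarith)]
  have h1 : r * (f' (r - d) * η r + f (r - d) * -deriv Real.smoothTransition (n + 1 - r) -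
      f' (r - d) / f (r - d) * (f (r - d) * η r)) ^ 2 +
      d / (r - d) * (f' (r - d) / f (r - d)) * (f (r - d) * η r) ^ 2 =
      r * f (r - d) ^ 2 * deriv Real.smoothTransition (n + 1 - r) ^ 2 + p r * η r ^ 2 := by
    simp only [hp]
    field_simp
    ring
  rw [h1, add_comm]
  refine add_le_add ?_ ?_
  · by_cases hr1 : r ≤ R + d + 1
    · rw [indicator_of_mem (show r ∈ Icc (R + d) (R + d + 1) from ⟨hr'.le, hr1⟩)]
      have : η r = 1 := Real.smoothTransition.one_of_one_le (by linarith)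
      rw [this]; simp
    · rw [indicator_of_notMem fun hmem ↦ hr1 hmem.2]
      have := hp_neg r hr'.le
      nlinarith [sq_nonneg (η r)]
  · by_cases hrn : r ∈ Icc n (n + 1)
    · rw [indicator_of_mem hrn]
      have h2 := (hn r hrn.1).1
      have h3 : deriv Real.smoothTransition (n + 1 - r) ^ 2 ≤ C ^ 2 :=
        sq_le_sq' (abs_le.1 (hC _)).1 (abs_le.1 (hC _)).2
      have h4 := mul_le_mul_of_nonneg_left h3 (by positivity : 0 ≤ r * f (r - d) ^ 2)
      linarith
    · rw [indicator_of_notMem hrn, deriv_smoothTransition_eq_zero]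
      · simp
      · exact fun hmem ↦ hrn ⟨by linarith [hmem.2], by linarith [hmem.1]⟩

/-! ### Polar coordinates around a point of the plane -/

/-- The standard identification of `ℂ` with the Euclidean plane. -/
def planeIso : ℂ ≃ₗᵢ[ℝ] E2 := Complex.orthonormalBasisOneI.repr

/-- The unit vector of the plane with polar angle `θ`. -/
def dir (θ : ℝ) : E2 := planeIso (Complex.exp (θ * Complex.I))

lemma continuous_dir : Continuous dir :=
  planeIso.continuous.comp (by fun_prop)

lemma norm_dir (θ : ℝ) : ‖dir θ‖ = 1 := by
  rw [dir, LinearIsometryEquiv.norm_map, Complex.norm_exp_ofReal_mul_I]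

lemma dist_add_smul_dir (c : E2) {r : ℝ} (hr : 0 ≤ r) (θ : ℝ) : dist (c + r • dir θ) c = r := by
  rw [dist_eq_norm, add_sub_cancel_left, norm_smul, norm_dir, mul_one, Real.norm_of_nonneg hr]

lemma smul_dir (r θ : ℝ) :
    r • dir θ = planeIso (r * (Real.cos θ + Real.sin θ * Complex.I)) := by
  rw [dir, ← map_smul, Complex.exp_mul_I, Complex.real_smul]
  simp

lemma extDom_ball (c : E2) {R : ℝ} (hR : R ≠ 0) : extDom (ball c R) = (closedBall c R)ᶜ := by
  rw [extDom, closure_ball c hR]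

lemma setIntegral_extDom_ball (c : E2) {R : ℝ} (hR : 0 < R) (F : E2 → ℝ) :
    ∫ x in extDom (ball c R), F x =
      ∫ p in Ioi R ×ˢ Ioo (-π) π, p.1 * F (c + p.1 • dir p.2) := by
  have hm : MeasurableSet (closedBall c R)ᶜ := isClosed_closedBall.measurableSet.compl
  rw [extDom_ball c hR.ne', ← integral_indicator hm]
  set G := (closedBall c R)ᶜ.indicator F with hG
  have h1 : ∫ z : ℂ, G (c + planeIso z) = ∫ x, G x := by
    rw [(planeIso.measurePreserving).integral_comp planeIso.toMeasurableEquiv.measurableEmbedding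
      (fun x ↦ G (c + x)), integral_add_left_eq_self]
  rw [← h1, ← Complex.integral_comp_polarCoord_symm, ← integral_indicator
    polarCoord.open_target.measurableSet, ← integral_indicator
    (measurableSet_Ioi.prod measurableSet_Ioo)]
  congr 1
  ext ⟨r, θ⟩
  simp only [indicator, polarCoord_target, mem_prod, mem_Ioi, smul_eq_mul,
    Complex.polarCoord_symm_apply, ← smul_dir, hG, mem_compl_iff, mem_closedBall, not_le]
  by_cases hθ : θ ∈ Ioo (-π) π <;> by_cases hr : 0 < r
  · simp [hθ, hr, dist_add_smul_dir c hr.le]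
  · simp only [hr, false_and, if_false, right_eq_ite_iff]
    exact fun h ↦ absurd (hR.trans h.1) hr
  · simp [hθ]
  · simp [hθ]

lemma hausdorffMeasure_unitCircle_lt_top : μH[1] (sphere (0 : ℂ) 1) < ⊤ := by
  have hsub : sphere (0 : ℂ) 1 ⊆ (fun θ : ℝ ↦ Complex.exp (θ * Complex.I)) '' Icc (-π) π := by
    intro z hz
    refine ⟨z.arg, ⟨(Complex.neg_pi_lt_arg z).le, Complex.arg_le_pi z⟩, ?_⟩
    have h := Complex.norm_mul_exp_arg_mul_I z
    rw [mem_sphere_zero_iff_norm.1 hz] at h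
    simpa using h
  have hlip : LipschitzWith 1 (fun θ : ℝ ↦ Complex.exp (θ * Complex.I)) := by
    refine lipschitzWith_of_nnnorm_deriv_le ?_ fun θ ↦ ?_
    · fun_prop
    · have h : HasDerivAt (fun θ : ℝ ↦ Complex.exp (θ * Complex.I))
          (Complex.exp (θ * Complex.I) * (1 * Complex.I)) θ :=
        ((Complex.ofRealCLM.hasDerivAt (x := θ)).mul_const Complex.I).cexp
      rw [h.deriv, ← NNReal.coe_le_coe]
      simp
  refine (measure_mono hsub).trans_lt
    ((hlip.hausdorffMeasure_image_le zero_le_one (Icc (-π) π)).trans_lt ?_)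
  rw [hausdorffMeasure_real]
  simp

lemma hausdorffMeasure_unitCircle_pos : 0 < μH[1] (sphere (0 : ℂ) 1) := by
  have hlip : LipschitzWith 1 Complex.re :=
    LipschitzWith.of_dist_le_mul fun z w ↦ by
      rw [NNReal.coe_one, one_mul, Real.dist_eq, dist_eq_norm, ← Complex.sub_re]
      exact Complex.abs_re_le_norm _
  have h := hlip.hausdorffMeasure_image_le zero_le_one (sphere (0 : ℂ) 1)
  have hsub : Icc (-1 : ℝ) 1 ⊆ Complex.re '' sphere (0 : ℂ) 1 := by
    intro x hx
    refine ⟨Complex.exp (Real.arccos x * Complex.I), ?_, ?_⟩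
    · rw [mem_sphere_zero_iff_norm, Complex.norm_exp_ofReal_mul_I]
    · rw [Complex.exp_ofReal_mul_I_re, Real.cos_arccos hx.1 hx.2]
  have h2 := measure_mono (μ := (μH[1] : Measure ℝ)) hsub
  rw [hausdorffMeasure_real, Real.volume_Icc] at h2
  rw [hausdorffMeasure_real] at h
  simp only [ENNReal.coe_one, ENNReal.one_rpow, one_mul] at h
  refine lt_of_lt_of_le ?_ (h2.trans h)
  norm_num

open scoped Pointwise in
lemma hausdorffMeasure_circle {R : ℝ} (hR : 0 < R) :
    μH[1] (sphere (0 : ℂ) R) = ENNReal.ofReal R * μH[1] (sphere (0 : ℂ) 1) := by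
  have h : sphere (0 : ℂ) R = R • sphere (0 : ℂ) 1 := by
    rw [smul_sphere' hR.ne']
    simp [abs_of_pos hR]
  rw [h, Measure.hausdorffMeasure_smul₀ zero_le_one hR.ne', ENNReal.smul_def, smul_eq_mul,
    NNReal.rpow_one]
  congr 1
  rw [← ENNReal.ofReal_coe_nnreal, coe_nnnorm, Real.norm_of_nonneg hR.le]

/-- Arc length measure on a circle is proportional to the angular measure. -/
lemma setIntegral_circle {R : ℝ} (hR : 0 < R) {h : ℂ → ℝ} (hh : Continuous h) :
    ∫ z in sphere (0 : ℂ) R, h z ∂μH[1] = μH[1].real (sphere (0 : ℂ) 1) / (2 * π) *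
      (R * ∫ θ in Ioo (-π) π, h (R * Complex.exp (θ * Complex.I))) := by
  set ν : Measure ℂ := μH[1].restrict (sphere (0 : ℂ) R) with hν
  have hmass : μH[1] (sphere (0 : ℂ) R) < ⊤ := by
    rw [hausdorffMeasure_circle hR]
    exact ENNReal.mul_lt_top ENNReal.ofReal_lt_top hausdorffMeasure_unitCircle_lt_top
  have : IsFiniteMeasure ν := ⟨by rwa [hν, Measure.restrict_apply_univ]⟩
  have hrot : ∀ θ : ℝ, ∫ z, h (Complex.exp (θ * Complex.I) * z) ∂ν = ∫ z, h z ∂ν := by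
    intro θ
    let e : ℂ ≃ᵢ ℂ := (rotation (Circle.exp θ)).toIsometryEquiv
    have he : ∀ z, e z = Complex.exp (θ * Complex.I) * z := fun z ↦ by
      simp [e, rotation_apply]
    have hp : e ⁻¹' sphere (0 : ℂ) R = sphere (0 : ℂ) R := by
      ext z
      rw [mem_preimage, he, mem_sphere_zero_iff_norm, norm_mul, Complex.norm_exp_ofReal_mul_I,
        one_mul, mem_sphere_zero_iff_norm]
    have hmp := (e.measurePreserving_hausdorffMeasure 1).setIntegral_preimage_emb
      e.toHomeomorph.measurableEmbedding h (sphere (0 : ℂ) R)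
    rw [hp] at hmp
    simpa only [he] using hmp
  obtain ⟨M, hM⟩ := (isCompact_sphere (0 : ℂ) R).exists_bound_of_continuousOn hh.continuousOn
  have hint : Integrable (Function.uncurry fun (θ : ℝ) (z : ℂ) ↦
      h (Complex.exp (θ * Complex.I) * z)) ((volume.restrict (Ioo (-π) π)).prod ν) := by
    refine Integrable.of_bound (C := M) ?_ ?_
    · exact (hh.comp (by fun_prop : Continuous fun p : ℝ × ℂ ↦
        Complex.exp (p.1 * Complex.I) * p.2)).aestronglyMeasurable
    · have hae : ∀ᵐ z ∂ν, z ∈ sphere (0 : ℂ) R := ae_restrict_mem isClosed_sphere.measurableSet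
      filter_upwards [Measure.quasiMeasurePreserving_snd.ae hae] with p hp
      refine hM _ ?_
      simpa [Complex.norm_exp_ofReal_mul_I] using hp
  have hswap := integral_integral_swap hint
  simp only [hrot] at hswap
  set A := ∫ θ in Ioo (-π) π, h (R * Complex.exp (θ * Complex.I)) with hA
  have hinner : ∀ z ∈ sphere (0 : ℂ) R,
      ∫ θ in Ioo (-π) π, h (Complex.exp (θ * Complex.I) * z) = A := by
    intro z hz
    have hz' : z = R * Complex.exp (z.arg * Complex.I) := by
      have h := Complex.norm_mul_exp_arg_mul_I z
      rw [mem_sphere_zero_iff_norm.1 hz] at h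
      exact h.symm
    set q : ℝ → ℝ := fun θ ↦ h (R * Complex.exp (θ * Complex.I)) with hq
    have hper : Function.Periodic q (2 * π) := fun θ ↦ by
      simp only [hq]
      rw [Complex.ofReal_add, add_mul, Complex.exp_add]
      simp
    have h1 : ∀ θ : ℝ, h (Complex.exp (θ * Complex.I) * z) = q (θ + z.arg) := fun θ ↦ by
      simp only [hq]
      rw [Complex.ofReal_add, add_mul, Complex.exp_add]
      congr 1
      nth_rewrite 1 [hz']
      ring
    have hle : -π ≤ π := by linarith [Real.pi_pos]
    simp only [h1, hA]
    rw [← integral_Ioc_eq_integral_Ioo, ← integral_Ioc_eq_integral_Ioo,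
      ← intervalIntegral.integral_of_le hle, ← intervalIntegral.integral_of_le hle,
      intervalIntegral.integral_comp_add_right]
    have := hper.intervalIntegral_add_eq (-π + z.arg) (-π)
    convert this using 2 <;> ring
  have hright : ∫ z, (∫ θ in Ioo (-π) π, h (Complex.exp (θ * Complex.I) * z)) ∂ν =
      μH[1].real (sphere (0 : ℂ) 1) * R * A := by
    rw [hν, setIntegral_congr_fun isClosed_sphere.measurableSet hinner, setIntegral_const,
      smul_eq_mul, measureReal_def, measureReal_def, hausdorffMeasure_circle hR, ENNReal.toReal_mul,
      ENNReal.toReal_ofReal hR.le]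
    ring
  rw [hright, setIntegral_const, Real.volume_real_Ioo_of_le (by linarith [Real.pi_pos]),
    smul_eq_mul] at hswap
  have := Real.pi_pos
  field_simp
  linarith

/-- The density of arc length with respect to the angle on the unit circle. -/
def arcDensity : ℝ := μH[1].real (sphere (0 : ℂ) 1) / (2 * π)

lemma arcDensity_pos : 0 < arcDensity :=
  div_pos (ENNReal.toReal_pos hausdorffMeasure_unitCircle_pos.ne'
    hausdorffMeasure_unitCircle_lt_top.ne) (by positivity)

lemma setIntegral_frontier_ball (c : E2) {R : ℝ} (hR : 0 < R) {h : E2 → ℝ} (hh : Continuous h) :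
    ∫ x in frontier (ball c R), h x ∂μH[1] =
      arcDensity * (R * ∫ θ in Ioo (-π) π, h (c + R • dir θ)) := by
  let e : ℂ ≃ᵢ E2 := planeIso.toIsometryEquiv.trans (IsometryEquiv.addLeft c)
  have he : ∀ z, e z = c + planeIso z := fun z ↦ rfl
  have hp : e ⁻¹' sphere c R = sphere (0 : ℂ) R := by
    ext z
    rw [mem_preimage, he, mem_sphere_iff_norm, add_sub_cancel_left, LinearIsometryEquiv.norm_map,
      mem_sphere_zero_iff_norm]
  have hmp := (e.measurePreserving_hausdorffMeasure 1).setIntegral_preimage_emb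
    e.toHomeomorph.measurableEmbedding h (sphere c R)
  rw [frontier_ball c hR.ne', ← hmp, hp, setIntegral_circle (h := fun z ↦ h (e z)) hR
    (hh.comp e.continuous), arcDensity]
  congr 3
  ext θ
  rw [he, dir, ← map_smul, Complex.real_smul]

lemma continuous_add_smul_dir (c : E2) : Continuous fun p : ℝ × ℝ ↦ c + p.1 • dir p.2 :=
  continuous_const.add (continuous_fst.smul (continuous_dir.comp continuous_snd))

lemma integrableOn_polar (c : E2) {R : ℝ} (hR : 0 < R) {F : E2 → ℝ} (hF : Continuous F) {L : ℝ}
    (hL : ∀ x, L ≤ dist x c → F x = 0) :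
    IntegrableOn (fun p : ℝ × ℝ ↦ p.1 * F (c + p.1 • dir p.2)) (Ioi R ×ˢ Ioo (-π) π) := by
  have hc : Continuous fun p : ℝ × ℝ ↦ p.1 * F (c + p.1 • dir p.2) :=
    continuous_fst.mul (hF.comp (continuous_add_smul_dir c))
  refine IntegrableOn.of_forall_sdiff_eq_zero (hc.continuousOn.integrableOn_compact
    (isCompact_Icc.prod isCompact_Icc : IsCompact (Icc R L ×ˢ Icc (-π) π)))
    (measurableSet_Ioi.prod measurableSet_Ioo) fun p hp ↦ ?_
  obtain ⟨⟨hr, hθ⟩, hn⟩ := hp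
  have hr : R < p.1 := hr
  have hrL : L ≤ p.1 := by
    by_contra hlt
    exact hn ⟨⟨hr.le, (not_le.1 hlt).le⟩, Ioo_subset_Icc_self hθ⟩
  rw [hL _ (by rwa [dist_add_smul_dir c (hR.trans hr).le]), mul_zero]

lemma setIntegral_extDom_ball_eq_iterated (c : E2) {R : ℝ} (hR : 0 < R) {F : E2 → ℝ}
    (hF : Continuous F) {L : ℝ} (hL : ∀ x, L ≤ dist x c → F x = 0) :
    IntegrableOn (fun θ ↦ ∫ r in Ioi R, r * F (c + r • dir θ)) (Ioo (-π) π) ∧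
      ∫ x in extDom (ball c R), F x =
        ∫ θ in Ioo (-π) π, ∫ r in Ioi R, r * F (c + r • dir θ) := by
  have hi := integrableOn_polar c hR hF hL
  have hsw : IntegrableOn (fun p : ℝ × ℝ ↦ p.2 * F (c + p.2 • dir p.1)) (Ioo (-π) π ×ˢ Ioi R)
      (volume.prod volume) := hi.swap
  constructor
  · rw [IntegrableOn, ← Measure.prod_restrict] at hsw
    exact hsw.integral_prod_left
  · rw [setIntegral_extDom_ball c hR, ← setIntegral_prod _ hsw, Measure.volume_eq_prod,
      ← setIntegral_prod_swap]
    rfl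

/-- The numerator of the Rayleigh quotient. -/
def robinForm (α : ℝ) (Ω : Set E2) (u : E2 → ℝ) : ℝ :=
  (∫ x in extDom Ω, ‖fderiv ℝ u x‖ ^ 2) + α * ∫ x in frontier Ω, (u x) ^ 2 ∂(μH[1])

lemma robinForm_add_eq (α k : ℝ) (c : E2) {R : ℝ} (hR : 0 < R) {u : E2 → ℝ}
    (hu : ContDiff ℝ ∞ u) (hs : HasCompactSupport u) :
    IntegrableOn (fun θ ↦ ∫ r in Ioi R, r * (‖fderiv ℝ u (c + r • dir θ)‖ ^ 2 +
      k ^ 2 * u (c + r • dir θ) ^ 2)) (Ioo (-π) π) ∧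
    robinForm α (ball c R) u + k ^ 2 * ∫ x in extDom (ball c R), u x ^ 2 =
      (∫ θ in Ioo (-π) π, ∫ r in Ioi R, r * (‖fderiv ℝ u (c + r • dir θ)‖ ^ 2 +
        k ^ 2 * u (c + r • dir θ) ^ 2)) +
      α * (arcDensity * (R * ∫ θ in Ioo (-π) π, u (c + R • dir θ) ^ 2)) := by
  have hdc : Continuous (fderiv ℝ u) := hu.continuous_fderiv (by simp)
  have hds : HasCompactSupport (fderiv ℝ u) := hs.fderiv ℝ
  have h1 : Integrable fun x ↦ ‖fderiv ℝ u x‖ ^ 2 :=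
    Continuous.integrable_of_hasCompactSupport (hdc.norm.pow 2)
      (hds.mono fun x hx h0 ↦ hx (by simp [h0]))
  have h2 : Integrable fun x ↦ k ^ 2 * u x ^ 2 :=
    Continuous.integrable_of_hasCompactSupport ((hu.continuous.pow 2).const_mul _)
      (hs.mono fun x hx h0 ↦ hx (by simp [h0]))
  obtain ⟨L, hL⟩ := (hs.isCompact.union hds.isCompact).isBounded.subset_ball c
  have hzero : ∀ x, L ≤ dist x c → ‖fderiv ℝ u x‖ ^ 2 + k ^ 2 * u x ^ 2 = 0 := fun x hx ↦ by
    have hx' : x ∉ tsupport u ∪ tsupport (fderiv ℝ u) := fun h ↦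
      absurd (mem_ball.1 (hL h)) (not_lt.2 hx)
    rw [image_eq_zero_of_notMem_tsupport fun h ↦ hx' (Or.inl h),
      image_eq_zero_of_notMem_tsupport fun h ↦ hx' (Or.inr h)]
    simp
  have hF : Continuous fun x ↦ ‖fderiv ℝ u x‖ ^ 2 + k ^ 2 * u x ^ 2 :=
    (hdc.norm.pow 2).add ((hu.continuous.pow 2).const_mul (k ^ 2))
  obtain ⟨hi, he⟩ := setIntegral_extDom_ball_eq_iterated
    (F := fun x ↦ ‖fderiv ℝ u x‖ ^ 2 + k ^ 2 * u x ^ 2) c hR hF hzero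
  refine ⟨hi, ?_⟩
  have hsplit : ∫ x in extDom (ball c R), (‖fderiv ℝ u x‖ ^ 2 + k ^ 2 * u x ^ 2) =
      (∫ x in extDom (ball c R), ‖fderiv ℝ u x‖ ^ 2) +
        k ^ 2 * ∫ x in extDom (ball c R), u x ^ 2 := by
    rw [integral_add h1.integrableOn h2.integrableOn, integral_const_mul]
  rw [← he, hsplit, robinForm,
    setIntegral_frontier_ball (h := fun x ↦ u x ^ 2) c hR (hu.continuous.pow 2)]
  ring

lemma IsRobinProfile.robinForm_nonneg {α R k : ℝ} {f f' : ℝ → ℝ}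
    (h : IsRobinProfile (-α * arcDensity) R k f f') (hR : 0 < R) (c : E2) {u : E2 → ℝ}
    (hu : ContDiff ℝ ∞ u) (hs : HasCompactSupport u) :
    0 ≤ robinForm α (ball c R) u + k ^ 2 * ∫ x in extDom (ball c R), u x ^ 2 := by
  obtain ⟨hi, he⟩ := robinForm_add_eq α k c hR hu hs
  have hdc : Continuous (fderiv ℝ u) := hu.continuous_fderiv (by simp)
  have hds : HasCompactSupport (fderiv ℝ u) := hs.fderiv ℝ
  obtain ⟨L, hL⟩ := (hs.isCompact.union hds.isCompact).isBounded.subset_ball c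
  have hzero : ∀ x, max L 0 ≤ dist x c → u x = 0 ∧ fderiv ℝ u x = 0 := fun x hx ↦ by
    have hx' : x ∉ tsupport u ∪ tsupport (fderiv ℝ u) := fun h ↦
      absurd (mem_ball.1 (hL h)) (not_lt.2 ((le_max_left _ _).trans hx))
    exact ⟨image_eq_zero_of_notMem_tsupport fun h ↦ hx' (Or.inl h),
      image_eq_zero_of_notMem_tsupport fun h ↦ hx' (Or.inr h)⟩
  have hray : ∀ θ, -α * arcDensity * (R * u (c + R • dir θ) ^ 2) ≤
      ∫ r in Ioi R, r * (‖fderiv ℝ u (c + r • dir θ)‖ ^ 2 + k ^ 2 * u (c + r • dir θ) ^ 2) := by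
    intro θ
    have hline : Continuous fun r : ℝ ↦ c + r • dir θ := by fun_prop
    have hd : ∀ r, HasDerivAt (fun r ↦ u (c + r • dir θ))
        (fderiv ℝ u (c + r • dir θ) (dir θ)) r := fun r ↦ by
      have h1 : HasDerivAt (fun r : ℝ ↦ c + r • dir θ) (dir θ) r := by
        simpa using ((hasDerivAt_id r).smul_const (dir θ)).const_add c
      exact ((hu.differentiable (by simp) _).hasFDerivAt).comp_hasDerivAt r h1
    have hdir : Continuous fun r ↦ fderiv ℝ u (c + r • dir θ) (dir θ) :=
      (hdc.comp hline).clm_apply continuous_const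
    have hz : ∀ r, max L 0 ≤ r → u (c + r • dir θ) = 0 ∧ fderiv ℝ u (c + r • dir θ) = 0 :=
      fun r hr ↦ hzero _ (by rwa [dist_add_smul_dir c ((le_max_right _ _).trans hr)])
    refine (h.le_integral hR (L := max L 0) hd hdir (fun r hr ↦ (hz r hr).1)
      fun r hr ↦ by simp [(hz r hr).2]).trans ?_
    refine setIntegral_mono_on ?_ ?_ measurableSet_Ioi fun r (hr : R < r) ↦ ?_
    · exact integrableOn_Ioi_of_eq_zero (L := max L 0) (continuous_id.mul ((hdir.pow 2).add
        (((hu.continuous.comp hline).pow 2).const_mul _))).continuousOn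
        fun r hr ↦ by simp [(hz r hr).1, (hz r hr).2]
    · exact integrableOn_Ioi_of_eq_zero (L := max L 0) (continuous_id.mul
        (((hdc.comp hline).norm.pow 2).add
        (((hu.continuous.comp hline).pow 2).const_mul _))).continuousOn
        fun r hr ↦ by simp [(hz r hr).1, (hz r hr).2]
    · have h1 := (fderiv ℝ u (c + r • dir θ)).le_opNorm (dir θ)
      rw [norm_dir, mul_one, Real.norm_eq_abs] at h1
      have h2 : fderiv ℝ u (c + r • dir θ) (dir θ) ^ 2 ≤ ‖fderiv ℝ u (c + r • dir θ)‖ ^ 2 := by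
        rw [← sq_abs]
        exact pow_le_pow_left₀ (abs_nonneg _) h1 2
      have : 0 ≤ r := (hR.trans hr).le
      gcongr
  have hcont : Continuous fun θ ↦ -α * arcDensity * (R * u (c + R • dir θ) ^ 2) := by
    have := hu.continuous.comp (continuous_const.add (continuous_dir.const_smul R) :
      Continuous fun θ ↦ c + R • dir θ)
    exact ((this.pow 2).const_mul R).const_mul _
  have hmono := setIntegral_mono (μ := volume) (s := Ioo (-π) π)
    (hcont.integrableOn_Icc.mono_set Ioo_subset_Icc_self) hi hray
  rw [integral_const_mul, integral_const_mul] at hmono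
  rw [he]
  linarith

lemma contDiff_radial (c : E2) {φ : ℝ → ℝ} (hφ : ContDiff ℝ ∞ φ) {ε : ℝ} (hε : 0 < ε)
    (hφε : ∀ r, r ≤ ε → φ r = 0) : ContDiff ℝ ∞ fun x : E2 ↦ φ ‖x - c‖ := by
  refine contDiff_iff_contDiffAt.2 fun x ↦ ?_
  rcases eq_or_ne x c with rfl | hx
  · have : (fun y : E2 ↦ φ ‖y - x‖) =ᶠ[𝓝 x] fun _ ↦ 0 := by
      filter_upwards [ball_mem_nhds x hε] with y hy
      exact hφε _ (mem_ball_iff_norm.1 hy).le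
    exact contDiffAt_const.congr_of_eventuallyEq this
  · exact hφ.contDiffAt.comp x ((contDiffAt_id.sub contDiffAt_const).norm ℝ (sub_ne_zero.2 hx))

lemma norm_fderiv_radial_le (c : E2) {φ : ℝ → ℝ} (hφ : ContDiff ℝ ∞ φ) {x : E2} (hx : x ≠ c) :
    ‖fderiv ℝ (fun x : E2 ↦ φ ‖x - c‖) x‖ ≤ |deriv φ ‖x - c‖| := by
  have h1 : DifferentiableAt ℝ (fun x : E2 ↦ ‖x - c‖) x :=
    (differentiableAt_id.sub_const c).norm ℝ (sub_ne_zero.2 hx)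
  have h2 : HasDerivAt φ (deriv φ ‖x - c‖) ‖x - c‖ :=
    (hφ.differentiable (by simp) _).hasDerivAt
  have h3 : ‖fderiv ℝ (fun x : E2 ↦ ‖x - c‖) x‖ ≤ (1 : NNReal) := by
    refine norm_fderiv_le_of_lipschitz ℝ (LipschitzWith.of_dist_le_mul fun y z ↦ ?_)
    have := abs_norm_sub_norm_le (y - c) (z - c)
    rw [sub_sub_sub_cancel_right] at this
    rwa [NNReal.coe_one, one_mul, Real.dist_eq, dist_eq_norm]
  have h4 : HasFDerivAt (fun x : E2 ↦ φ ‖x - c‖)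
      (deriv φ ‖x - c‖ • fderiv ℝ (fun x : E2 ↦ ‖x - c‖) x) x :=
    h2.comp_hasFDerivAt x h1.hasFDerivAt
  rw [h4.fderiv, norm_smul, Real.norm_eq_abs]
  exact mul_le_of_le_one_right (abs_nonneg _) (by simpa using h3)

lemma IsRobinProfile.exists_robinForm_neg {α R R' k : ℝ} {f f' : ℝ → ℝ}
    (h : IsRobinProfile (-α * arcDensity) R k f f') (hR : 0 < R) (hRR' : R < R') (c : E2) :
    ∃ u : E2 → ℝ, ContDiff ℝ ∞ u ∧ HasCompactSupport u ∧
      robinForm α (ball c R') u + k ^ 2 * ∫ x in extDom (ball c R'), u x ^ 2 < 0 := by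
  obtain ⟨φ, hφ, ⟨ε, hε, hφε⟩, ⟨L, hL⟩, hlt⟩ := h.exists_test hR (sub_pos.2 hRR')
  rw [add_sub_cancel] at hlt
  have hR' : 0 < R' := hR.trans hRR'
  have hu := contDiff_radial c hφ hε hφε
  have hs : HasCompactSupport fun x : E2 ↦ φ ‖x - c‖ :=
    HasCompactSupport.intro (isCompact_closedBall c L) fun x hx ↦ hL _ (by
      rw [mem_closedBall, not_le, dist_eq_norm] at hx; exact hx.le)
  refine ⟨_, hu, hs, ?_⟩
  obtain ⟨hi, he⟩ := robinForm_add_eq α k c hR' hu hs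
  have hn : ∀ θ r, 0 < r → ‖c + r • dir θ - c‖ = r := fun θ r hr ↦ by
    rw [← dist_eq_norm, dist_add_smul_dir c hr.le]
  have hdc := hu.continuous_fderiv (by simp)
  have hφ'L : ∀ r, L + 1 ≤ r → deriv φ r = 0 := fun r hr ↦ by
    have he : φ =ᶠ[𝓝 r] fun _ ↦ 0 := by
      filter_upwards [Ioi_mem_nhds (show L < r by linarith)] with y hy
      exact hL y (mem_Ioi.1 hy).le
    rw [he.deriv_eq, deriv_const]
  have hφ'c : Continuous (deriv φ) := hφ.continuous_deriv (by simp)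
  have hφc : Continuous φ := hφ.continuous
  have hbound : ∀ θ r, 0 < r → r * (‖fderiv ℝ (fun x ↦ φ ‖x - c‖) (c + r • dir θ)‖ ^ 2 +
      k ^ 2 * φ ‖c + r • dir θ - c‖ ^ 2) ≤ r * (deriv φ r ^ 2 + k ^ 2 * φ r ^ 2) := by
    intro θ r hr
    have h1 := norm_fderiv_radial_le c hφ (x := c + r • dir θ) (by
      rw [← dist_pos, dist_add_smul_dir c hr.le]; exact hr)
    rw [hn θ r hr] at h1 ⊢
    have h2 := pow_le_pow_left₀ (norm_nonneg _) h1 2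
    rw [sq_abs] at h2
    gcongr
  have hgi : IntegrableOn (fun r ↦ r * (deriv φ r ^ 2 + k ^ 2 * φ r ^ 2)) (Ioi R') :=
    integrableOn_Ioi_of_eq_zero (L := L + 1) (by fun_prop) fun r hr ↦ by
      simp [hφ'L r hr, hL r (by linarith)]
  have hray : ∀ θ, ∫ r in Ioi R', r * (‖fderiv ℝ (fun x ↦ φ ‖x - c‖) (c + r • dir θ)‖ ^ 2 +
      k ^ 2 * φ ‖c + r • dir θ - c‖ ^ 2) ≤
      ∫ r in Ioi R', r * (deriv φ r ^ 2 + k ^ 2 * φ r ^ 2) := fun θ ↦ by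
    refine integral_mono_of_nonneg ?_ hgi ?_ <;>
      refine (ae_restrict_iff' measurableSet_Ioi).2 (.of_forall fun r (hr : R' < r) ↦ ?_)
    · have := hR'.trans hr
      simp only [Pi.zero_apply]; positivity
    · exact hbound θ r (hR'.trans hr)
  have hmono := setIntegral_mono (μ := volume) (s := Ioo (-π) π) hi
    (integrableOn_const (by simp)) hray
  simp only [hn _ R' hR'] at he
  have hvol : volume.real (Ioo (-π) π) = 2 * π := by
    rw [Real.volume_real_Ioo_of_le (by linarith [Real.pi_pos])]; ring
  rw [setIntegral_const, hvol, smul_eq_mul] at hmono he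
  have := mul_lt_mul_of_pos_left hlt Real.two_pi_pos
  rw [he]
  linarith

lemma neg_sq_le_robinForm_div {α k : ℝ} {Ω : Set E2} {u : E2 → ℝ}
    (h : 0 ≤ robinForm α Ω u + k ^ 2 * ∫ x in extDom Ω, u x ^ 2) :
    -k ^ 2 ≤ robinForm α Ω u / ∫ x in extDom Ω, u x ^ 2 := by
  have hM : 0 ≤ ∫ x in extDom Ω, u x ^ 2 := integral_nonneg fun x ↦ sq_nonneg _
  rcases hM.eq_or_lt with h0 | h0
  · rw [← h0, div_zero]
    linarith [sq_nonneg k]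
  · rw [le_div_iff₀ h0]
    linarith

/-- The lowest Robin eigenvalue of the exterior of a disk is strictly decreasing in
the radius. -/
theorem robinEig_ball_strict_anti
    (α : ℝ) (hα : α < 0) (R R' : ℝ) (hR : 0 < R) (hRR' : R < R') (c c' : E2) :
    robinEig α (ball c' R') < robinEig α (ball c R) := by
  have hR' : 0 < R' := hR.trans hRR'
  have hβ : 0 < -α * arcDensity := mul_pos (neg_pos.2 hα) arcDensity_pos
  obtain ⟨k, f, f', -, hf⟩ := exists_isRobinProfile hβ hR
  obtain ⟨k', g, g', -, hg⟩ := exists_isRobinProfile hβ hR'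
  have hlower : -k ^ 2 ≤ robinEig α (ball c R) := by
    rw [robinEig]
    refine (Set.eq_empty_or_nonempty _).elim (fun he ↦ ?_) fun hne ↦ le_csInf hne ?_
    · rw [he, Real.sInf_empty]
      linarith [sq_nonneg k]
    · rintro q ⟨u, hu, hs, -, rfl⟩
      exact neg_sq_le_robinForm_div (hf.robinForm_nonneg hR c hu hs)
  refine lt_of_lt_of_le ?_ hlower
  obtain ⟨u, hu, hs, hneg⟩ := hf.exists_robinForm_neg hR hRR' c'
  have hnonneg := hg.robinForm_nonneg hR' c' hu hs
  have hM : 0 ≤ ∫ x in extDom (ball c' R'), u x ^ 2 := integral_nonneg fun x ↦ sq_nonneg _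
  have hM0 : (∫ x in extDom (ball c' R'), u x ^ 2) ≠ 0 := fun h0 ↦ by
    rw [h0, mul_zero] at hneg hnonneg
    linarith
  have hne : ∃ x ∈ extDom (ball c' R'), u x ≠ 0 := by
    by_contra! hz
    exact hM0 (setIntegral_eq_zero_of_forall_eq_zero fun x hx ↦ by simp [hz x hx])
  rw [robinEig]
  refine lt_of_le_of_lt (csInf_le ⟨-k' ^ 2, ?_⟩ ⟨u, hu, hs, hne, rfl⟩) ?_
  · rintro q ⟨v, hv, hvs, -, rfl⟩
    exact neg_sq_le_robinForm_div (hg.robinForm_nonneg hR' c' hv hvs)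
  · change robinForm α (ball c' R') u / (∫ x in extDom (ball c' R'), u x ^ 2) < _
    rw [div_lt_iff₀ (hM.lt_of_ne' hM0)]
    linarith

end
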